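/- arXiv:2503.08081 — 4 statements merged into one kernel-verified Lean document; each statement's English description precedes it below -/
import Mathlib

section
/- Let n, m, T be positive integers. Let A (n×n), B (n×m), U₀ (m×T), X₀ (n×T), X₁ (n×T) be real matrices with X₁ = A·X₀ + B·U₀. Let P be a positive definite real n×n matrix and H a real T×n matrix with X₀·H = P⁻¹. If the symmetric matrix X₁·H + Hᵀ·X₁ᵀ is negative definite, then, setting K = U₀·H·P, the matrix (A + B·K)ᵀ·P + P·(A + B·K) is negative definite. -/
open Matrix

/-- Data-driven control Lyapunov function condition for continuous-time linear
systems: from data satisfying `X₁ = A X₀ + B U₀` and a solution `H` of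
`X₀ H = P⁻¹` with `X₁ H + Hᵀ X₁ᵀ ≺ 0`, the closed-loop matrix `A + B K` with
`K = U₀ H P` satisfies the strict Lyapunov inequality. -/
theorem data_driven_clf_ctLS
    (n m T : ℕ) (hn : 0 < n) (hm : 0 < m) (hT : 0 < T)
    (A : Matrix (Fin n) (Fin n) ℝ) (B : Matrix (Fin n) (Fin m) ℝ)
    (U₀ : Matrix (Fin m) (Fin T) ℝ) (X₀ : Matrix (Fin n) (Fin T) ℝ)
    (X₁ : Matrix (Fin n) (Fin T) ℝ)
    (hdata : X₁ = A * X₀ + B * U₀)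
    (P : Matrix (Fin n) (Fin n) ℝ) (hP : P.PosDef)
    (H : Matrix (Fin T) (Fin n) ℝ) (hH : X₀ * H = P⁻¹)
    (hneg : (-(X₁ * H + Hᵀ * X₁ᵀ)).PosDef) :
    (-((A + B * (U₀ * H * P))ᵀ * P + P * (A + B * (U₀ * H * P)))).PosDef := by
  have hPu : IsUnit P := hP.isUnit
  have hPt : Pᵀ = P := by simpa [IsHermitian] using hP.1
  have hcl : A + B * (U₀ * H * P) = X₁ * H * P := by
    rw [hdata, Matrix.add_mul, Matrix.add_mul, Matrix.mul_assoc A, hH, Matrix.mul_assoc A,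
      nonsing_inv_mul P ((isUnit_iff_isUnit_det P).mp hPu), Matrix.mul_one]
    simp only [Matrix.mul_assoc]
  have hconj := hneg.conjTranspose_mul_mul_same (mulVec_injective_of_isUnit hPu)
  rw [conjTranspose_eq_transpose_of_trivial, hPt] at hconj
  convert hconj using 1
  rw [hcl]
  simp only [transpose_mul, hPt, Matrix.mul_neg, Matrix.neg_mul, Matrix.mul_add, Matrix.add_mul,
    Matrix.mul_assoc]
  rw [add_comm]
end

section
/- Let n be a positive integer, P a positive definite real n×n matrix, and M a real n×n matrix. If the 2n×2n block matrix [[P⁻¹, M·P⁻¹], [P⁻¹·Mᵀ, P⁻¹]] is positive semidefinite, then P - Mᵀ·P·M is positive semidefinite; equivalently, (M·v)ᵀ·P·(M·v) ≤ vᵀ·P·v for every v ∈ ℝⁿ. -/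
open Matrix

/-- One-step decrease deduction for the discrete-time barrier LMI: if
`[[P⁻¹, M P⁻¹], [P⁻¹ Mᵀ, P⁻¹]] ⪰ 0` with `P ≻ 0`, then `P - Mᵀ P M ⪰ 0`;
equivalently the quadratic form `yᵀ P y` is nonincreasing under `y ↦ M y`. -/
theorem discrete_barrier_decrease
    (n : ℕ) (hn : 0 < n)
    (P M : Matrix (Fin n) (Fin n) ℝ) (hP : P.PosDef)
    (hblock : (Matrix.fromBlocks P⁻¹ (M * P⁻¹) (P⁻¹ * Mᵀ) P⁻¹).PosSemidef) :
    (P - Mᵀ * P * M).PosSemidef ∧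
      ∀ v : Fin n → ℝ, (M.mulVec v) ⬝ᵥ P.mulVec (M.mulVec v) ≤ v ⬝ᵥ P.mulVec v := by
  have hdet : IsUnit P.det := P.isUnit_iff_isUnit_det.mp hP.isUnit
  have hPt : Pᵀ = P := hP.isHermitian
  have hinv : (P⁻¹).PosDef := hP.inv
  have : Invertible P⁻¹ := hinv.isUnit.invertible
  have hconj : (M * P⁻¹)ᴴ = P⁻¹ * Mᵀ := by
    rw [conjTranspose_mul, hinv.isHermitian.eq, conjTranspose_eq_transpose_of_trivial]
  rw [← hconj, hinv.fromBlocks₁₁, hconj, nonsing_inv_nonsing_inv P hdet] at hblock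
  have hdecrease : (P - Mᵀ * P * M).PosSemidef := by
    have h := hblock.conjTranspose_mul_mul_same P
    rwa [conjTranspose_eq_transpose_of_trivial, hPt, Matrix.mul_sub, Matrix.sub_mul,
      mul_nonsing_inv P hdet, Matrix.one_mul, Matrix.mul_assoc P, Matrix.mul_assoc (_ * P),
      nonsing_inv_mul_cancel_right _ _ hdet, Matrix.mul_assoc, Matrix.mul_assoc,
      mul_nonsing_inv_cancel_left _ _ hdet, ← Matrix.mul_assoc] at h
  refine ⟨hdecrease, fun v ↦ ?_⟩
  have h := hdecrease.dotProduct_mulVec_nonneg v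
  rw [star_trivial, sub_mulVec, dotProduct_sub, sub_nonneg, Matrix.mul_assoc,
    ← mulVec_mulVec, ← mulVec_mulVec, dotProduct_mulVec, vecMul_transpose] at h
  exact h
end

section
/- Let n be a positive integer, P a positive definite real n×n matrix, and M a real n×n matrix such that P - Mᵀ·P·M is positive definite. Then for every x₀ ∈ ℝⁿ, the sequence k ↦ Mᵏ·x₀ tends to the zero vector as k → ∞. -/
open Matrix

/-- The quadratic form of a positive definite matrix is coercive. -/
lemma Matrix.PosDef.exists_pos_mul_sq_norm_le {ι : Type*} [Fintype ι] {Q : Matrix ι ι ℝ}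
    (hQ : Q.PosDef) : ∃ c : ℝ, 0 < c ∧ ∀ v : ι → ℝ, c * ‖v‖ ^ 2 ≤ v ⬝ᵥ Q *ᵥ v := by
  have hcont : Continuous fun v : ι → ℝ => v ⬝ᵥ Q *ᵥ v := by fun_prop
  have hpos : ∀ v ∈ Metric.sphere (0 : ι → ℝ) 1, 0 < v ⬝ᵥ Q *ᵥ v := fun v hv => by
    simpa using hQ.dotProduct_mulVec_pos (ne_zero_of_mem_unit_sphere ⟨v, hv⟩)
  obtain ⟨c, hc, hle⟩ := (isCompact_sphere (0 : ι → ℝ) 1).exists_forall_le' hcont.continuousOn hpos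
  refine ⟨c, hc, fun v => ?_⟩
  rcases eq_or_ne v 0 with rfl | hv
  · simp
  have hv' : ‖v‖ ≠ 0 := norm_ne_zero_iff.mpr hv
  have h := hle (‖v‖⁻¹ • v) (by simp [norm_smul, hv'])
  rw [mulVec_smul, smul_dotProduct, dotProduct_smul, smul_eq_mul, smul_eq_mul] at h
  calc c * ‖v‖ ^ 2 ≤ ‖v‖⁻¹ * (‖v‖⁻¹ * (v ⬝ᵥ Q *ᵥ v)) * ‖v‖ ^ 2 := by gcongr
    _ = v ⬝ᵥ Q *ᵥ v := by field_simp

lemma Matrix.dotProduct_sub_transpose_mul_mul_mulVec {ι : Type*} [Fintype ι]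
    (P M : Matrix ι ι ℝ) (v : ι → ℝ) :
    v ⬝ᵥ (P - Mᵀ * P * M) *ᵥ v = v ⬝ᵥ P *ᵥ v - (M *ᵥ v) ⬝ᵥ P *ᵥ (M *ᵥ v) := by
  rw [sub_mulVec, dotProduct_sub, ← mulVec_mulVec, ← mulVec_mulVec, dotProduct_mulVec v Mᵀ,
    vecMul_transpose]

/-- Stability conclusion of the strict discrete-time Lyapunov inequality: if
`P ≻ 0` and `P - Mᵀ P M ≻ 0`, then every trajectory `k ↦ Mᵏ x₀` of
`x⁺ = M x` converges to the origin as `k → ∞`. -/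
theorem lyapunov_stability_discrete
    (n : ℕ) (hn : 0 < n)
    (P M : Matrix (Fin n) (Fin n) ℝ)
    (hP : P.PosDef) (hLyap : (P - Mᵀ * P * M).PosDef) :
    ∀ x₀ : Fin n → ℝ,
      Filter.Tendsto (fun k : ℕ => (M ^ k).mulVec x₀) Filter.atTop (nhds 0) := by
  intro x₀
  obtain ⟨c, hc, hle⟩ := hLyap.exists_pos_mul_sq_norm_le
  set x : ℕ → Fin n → ℝ := fun k => (M ^ k) *ᵥ x₀
  set V : ℕ → ℝ := fun k => x k ⬝ᵥ P *ᵥ x k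
  have hV : ∀ k, 0 ≤ V k := fun k => by
    simpa using hP.posSemidef.dotProduct_mulVec_nonneg (x k)
  have hstep : ∀ k, c * ‖x k‖ ^ 2 ≤ V k - V (k + 1) := fun k => by
    have hx : x (k + 1) = M *ᵥ x k := by simp only [x, pow_succ', mulVec_mulVec]
    simpa only [V, hx, dotProduct_sub_transpose_mul_mul_mulVec] using hle (x k)
  have hsum : Summable fun k => c * ‖x k‖ ^ 2 := by
    refine summable_of_sum_range_le (c := V 0) (fun k => by positivity) fun m => ?_
    calc ∑ k ∈ Finset.range m, c * ‖x k‖ ^ 2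
        ≤ ∑ k ∈ Finset.range m, (V k - V (k + 1)) := Finset.sum_le_sum fun k _ => hstep k
      _ = V 0 - V m := Finset.sum_range_sub' V m
      _ ≤ V 0 := sub_le_self _ (hV m)
  have hsq := ((summable_mul_left_iff hc.ne').mp hsum).tendsto_atTop_zero
  rw [tendsto_zero_iff_norm_tendsto_zero]
  simpa using hsq.sqrt
end

section
/- Let n, N, m, T be positive integers. Let A (n×N), B (n×m), U₀ (m×T), N₀ (N×T), X₁ (n×T) be real matrices with X₁ = A·N₀ + B·U₀. Let P be a positive definite real n×n matrix, Θ a real N×n matrix admitting a left inverse (i.e., there exists a real n×N matrix L with L·Θ = I_n), and H a real T×n matrix with N₀·H = Θ·P⁻¹. Suppose the 2n×2n block matrix [[P⁻¹, X₁·H], [Hᵀ·X₁ᵀ, P⁻¹]] is positive semidefinite. Then for every x ∈ ℝⁿ, the vector x⁺ := A·(Θ·x) + B·(U₀·H·P·x) satisfies x⁺ = X₁·H·P·x and (x⁺)ᵀ·P·x⁺ ≤ xᵀ·P·x. -/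
open Matrix

/-- If the block matrix `[[P⁻¹, C], [Cᵀ, P⁻¹]]` is positive semidefinite with `P` positive definite,
then `x ↦ C P x` does not increase the quadratic form of `P`. -/
theorem Matrix.PosDef.dotProduct_mulVec_le_of_fromBlocks_inv {ι : Type*} [Fintype ι]
    [DecidableEq ι] {P C : Matrix ι ι ℝ} (hP : P.PosDef)
    (h : (fromBlocks P⁻¹ C Cᵀ P⁻¹).PosSemidef) (x : ι → ℝ) :
    ((C * P) *ᵥ x) ⬝ᵥ (P *ᵥ ((C * P) *ᵥ x)) ≤ x ⬝ᵥ (P *ᵥ x) := by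
  have hdet : IsUnit P.det := P.isUnit_iff_isUnit_det.mp hP.isUnit
  have : Invertible P⁻¹ := hP.inv.isUnit.invertible
  rw [← conjTranspose_eq_transpose_of_trivial C, PosDef.fromBlocks₁₁ C P⁻¹ hP.inv,
    nonsing_inv_nonsing_inv P hdet, conjTranspose_eq_transpose_of_trivial] at h
  have key := h.dotProduct_mulVec_nonneg (P *ᵥ x)
  rw [star_trivial, sub_mulVec, dotProduct_sub, sub_nonneg, mulVec_mulVec, mulVec_mulVec,
    nonsing_inv_mul P hdet, one_mulVec, dotProduct_comm (P *ᵥ x) x] at key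
  refine le_of_eq_of_le ?_ key
  simp only [← mulVec_mulVec]
  rw [dotProduct_mulVec (P *ᵥ x) Cᵀ, vecMul_transpose]

/-- One-step barrier decrease for discrete-time nonlinear polynomial systems:
with data `X₁ = A N₀ + B U₀`, a left-invertible `Θ`, `N₀ H = Θ P⁻¹`, and the
LMI `[[P⁻¹, X₁ H], [Hᵀ X₁ᵀ, P⁻¹]] ⪰ 0`, the closed-loop successor
`x⁺ = A (Θ x) + B (U₀ H P x)` equals `X₁ H P x` and satisfies
`(x⁺)ᵀ P x⁺ ≤ xᵀ P x`. -/
theorem data_driven_cbc_step_dtNPS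
    (n N m T : ℕ) (hn : 0 < n) (hN : 0 < N) (hm : 0 < m) (hT : 0 < T)
    (A : Matrix (Fin n) (Fin N) ℝ) (B : Matrix (Fin n) (Fin m) ℝ)
    (U₀ : Matrix (Fin m) (Fin T) ℝ) (N₀ : Matrix (Fin N) (Fin T) ℝ)
    (X₁ : Matrix (Fin n) (Fin T) ℝ)
    (hdata : X₁ = A * N₀ + B * U₀)
    (P : Matrix (Fin n) (Fin n) ℝ) (hP : P.PosDef)
    (Θ : Matrix (Fin N) (Fin n) ℝ)
    (hΘ : ∃ L : Matrix (Fin n) (Fin N) ℝ, L * Θ = 1)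
    (H : Matrix (Fin T) (Fin n) ℝ) (hH : N₀ * H = Θ * P⁻¹)
    (hblock : (Matrix.fromBlocks P⁻¹ (X₁ * H) (Hᵀ * X₁ᵀ) P⁻¹).PosSemidef) :
    ∀ x : Fin n → ℝ,
      A.mulVec (Θ.mulVec x) + B.mulVec ((U₀ * H * P).mulVec x)
          = (X₁ * H * P).mulVec x ∧
        (A.mulVec (Θ.mulVec x) + B.mulVec ((U₀ * H * P).mulVec x)) ⬝ᵥ
            P.mulVec (A.mulVec (Θ.mulVec x) + B.mulVec ((U₀ * H * P).mulVec x))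
          ≤ x ⬝ᵥ P.mulVec x := by
  intro x
  have hdet : IsUnit P.det := P.isUnit_iff_isUnit_det.mp hP.isUnit
  have hstep : A.mulVec (Θ.mulVec x) + B.mulVec ((U₀ * H * P).mulVec x)
      = (X₁ * H * P).mulVec x := by
    have hΘP : Θ = N₀ * H * P := by
      rw [hH, Matrix.mul_assoc, nonsing_inv_mul P hdet, Matrix.mul_one]
    rw [mulVec_mulVec, mulVec_mulVec, ← add_mulVec, hdata, hΘP]
    simp only [Matrix.add_mul, Matrix.mul_assoc]
  refine ⟨hstep, ?_⟩
  rw [hstep]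
  rw [← transpose_mul] at hblock
  exact hP.dotProduct_mulVec_le_of_fromBlocks_inv hblock x
end
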